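/- arXiv:1111.5448 — 2 statements merged into one kernel-verified Lean document; each statement's English description precedes it below -/
import Mathlib

section
/- Let (T, F) be a torsion theory in a homological category A. Then the torsion part T is M-hereditary for M the class of protosplit monomorphisms (i.e. for every protosplit monomorphism m : A → B with B ∈ T one has A ∈ T) if and only if the torsion-free reflector F : A → F is protoadditive. -/
open CategoryTheory CategoryTheory.Limits

universe v u v₂ u₂

namespace ProtoPaper

variable {C : Type u} [Category.{v} C]

section ZeroDefs

variable [HasZeroMorphisms C]

/-- `k` is a kernel of `f`. -/
def IsKernelOf {K A B : C} (k : K ⟶ A) (f : A ⟶ B) : Prop :=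
  ∃ w : k ≫ f = 0, Nonempty (IsLimit (KernelFork.ofι k w))

/-- `f` is a cokernel of `k`. -/
def IsCokernelOf {K A B : C} (f : A ⟶ B) (k : K ⟶ A) : Prop :=
  ∃ w : k ≫ f = 0, Nonempty (IsColimit (CokernelCofork.ofπ f w))

/-- A normal monomorphism: a kernel of some morphism. -/
def IsNormalMonoArrow {K A : C} (k : K ⟶ A) : Prop :=
  ∃ (B : C) (f : A ⟶ B), IsKernelOf k f

/-- A normal epimorphism: a cokernel of some morphism. -/
def IsNormalEpiArrow {A B : C} (f : A ⟶ B) : Prop :=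
  ∃ (K : C) (k : K ⟶ A), IsCokernelOf f k

/-- A split short exact sequence `0 → K → A ⇄ B → 0`. -/
structure IsSplitShortExact {K A B : C} (k : K ⟶ A) (f : A ⟶ B) (s : B ⟶ A) : Prop where
  isKernel : IsKernelOf k f
  split : s ≫ f = 𝟙 B

/-- A short exact sequence `0 → K → A → B → 0`. -/
structure IsShortExact {K A B : C} (k : K ⟶ A) (f : A ⟶ B) : Prop where
  isKernel : IsKernelOf k f
  isCokernel : IsCokernelOf f k

/-- A protosplit monomorphism: a kernel of a split epimorphism. -/
def IsProtosplitMono {K A : C} (k : K ⟶ A) : Prop :=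
  ∃ (B : C) (f : A ⟶ B) (s : B ⟶ A), IsSplitShortExact k f s

end ZeroDefs

/-- A pointed category is protomodular when the split short five lemma holds. -/
def IsProtomodular (C : Type u) [Category.{v} C] [HasZeroMorphisms C] : Prop :=
  ∀ ⦃K A B K' A' B' : C⦄ (k : K ⟶ A) (f : A ⟶ B) (s : B ⟶ A)
    (k' : K' ⟶ A') (f' : A' ⟶ B') (s' : B' ⟶ A')
    (κ : K ⟶ K') (α : A ⟶ A') (β : B ⟶ B'),
    IsSplitShortExact k f s → IsSplitShortExact k' f' s' →
    k ≫ α = κ ≫ k' → f ≫ β = α ≫ f' → s ≫ α = β ≫ s' →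
    IsIso κ → IsIso β → IsIso α

section Functors

variable {D : Type u₂} [Category.{v₂} D]

/-- A functor is protoadditive if it preserves split short exact sequences. -/
def IsProtoadditive [HasZeroMorphisms C] [HasZeroMorphisms D] (F : C ⥤ D) : Prop :=
  ∀ ⦃K A B : C⦄ (k : K ⟶ A) (f : A ⟶ B) (s : B ⟶ A),
    IsSplitShortExact k f s → IsSplitShortExact (F.map k) (F.map f) (F.map s)

/-- A functor preserves zero objects. -/
def PreservesZeroObjects (F : C ⥤ D) : Prop :=
  ∀ X : C, IsZero X → IsZero (F.obj X)

/-- A functor preserves pullbacks along split epimorphisms. -/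
def PreservesPullbacksAlongSplitEpis (F : C ⥤ D) : Prop :=
  ∀ ⦃P X Y Z : C⦄ (fst : P ⟶ X) (snd : P ⟶ Y) (f : X ⟶ Z) (g : Y ⟶ Z),
    IsSplitEpi f → IsPullback fst snd f g →
    IsPullback (F.map fst) (F.map snd) (F.map f) (F.map g)

end Functors

/-- A homological category: pointed, protomodular and regular (finitely complete with
pullback-stable (regular epi, mono) factorisations). -/
structure IsHomological (C : Type u) [Category.{v} C] [HasZeroObject C]
    [HasZeroMorphisms C] : Prop where
  protomodular : IsProtomodular C
  hasFiniteLimits : HasFiniteLimits C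
  regEpiMonoFac : ∀ ⦃X Y : C⦄ (f : X ⟶ Y),
    ∃ (I : C) (e : X ⟶ I) (m : I ⟶ Y), Nonempty (RegularEpi e) ∧ Mono m ∧ e ≫ m = f
  regEpiStable : ∀ ⦃P X Y Z : C⦄ (fst : P ⟶ X) (snd : P ⟶ Y) (f : X ⟶ Z) (g : Y ⟶ Z),
    IsPullback fst snd f g → Nonempty (RegularEpi f) → Nonempty (RegularEpi snd)

/-- An internal equivalence relation, given by a jointly monic pair which is internally
reflexive, symmetric and transitive. -/
structure IsInternalEquivRel {R X : C} (p₁ p₂ : R ⟶ X) : Prop where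
  jointlyMono : ∀ ⦃Z : C⦄ (a b : Z ⟶ R), a ≫ p₁ = b ≫ p₁ → a ≫ p₂ = b ≫ p₂ → a = b
  refl : ∃ d : X ⟶ R, d ≫ p₁ = 𝟙 X ∧ d ≫ p₂ = 𝟙 X
  symm : ∃ σ : R ⟶ R, σ ≫ p₁ = p₂ ∧ σ ≫ p₂ = p₁
  trans : ∀ ⦃P : C⦄ (q₁ q₂ : P ⟶ R), IsPullback q₁ q₂ p₂ p₁ →
    ∃ t : P ⟶ R, t ≫ p₁ = q₁ ≫ p₁ ∧ t ≫ p₂ = q₂ ≫ p₂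

/-- A semi-abelian category: homological, with binary coproducts, and exact
(every internal equivalence relation is a kernel pair). -/
structure IsSemiAbelian (C : Type u) [Category.{v} C] [HasZeroObject C]
    [HasZeroMorphisms C] : Prop where
  homological : IsHomological C
  hasBinaryCoproducts : HasBinaryCoproducts C
  equivRelEffective : ∀ ⦃R X : C⦄ (p₁ p₂ : R ⟶ X), IsInternalEquivRel p₁ p₂ →
    ∃ (Y : C) (f : X ⟶ Y), IsPullback p₁ p₂ f f

/-- A full subcategory (given by a predicate on objects) is replete if it is closed
under isomorphisms. -/
def Replete (P : C → Prop) : Prop := ∀ ⦃X Y : C⦄, P X → (X ≅ Y) → P Y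

/-- A reflection of `C` onto the full subcategory of objects satisfying `P`:
a reflector `F`, a unit `η`, landing in `P`, with the usual universal property. -/
structure Reflection (C : Type u) [Category.{v} C] (P : C → Prop) where
  F : C ⥤ C
  η : 𝟭 C ⟶ F
  mem : ∀ X : C, P (F.obj X)
  univ : ∀ ⦃X B : C⦄, P B → ∀ f : X ⟶ B, ∃! g : F.obj X ⟶ B, η.app X ≫ g = f

variable {P : C → Prop}

/-- A (normal epi)-reflection: all units are normal epimorphisms. -/
def NormalEpiUnits [HasZeroMorphisms C] (R : Reflection C P) : Prop :=
  ∀ X : C, IsNormalEpiArrow (R.η.app X)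

/-- `f` is a trivial extension with respect to the reflection `R`. -/
def IsTrivialExt (R : Reflection C P) {A B : C} (f : A ⟶ B) : Prop :=
  IsPullback (R.η.app A) f (R.F.map f) (R.η.app B)

/-- `p` is an effective descent morphism: the pullback functor between the slice
categories is monadic. -/
def IsEffectiveDescent [HasPullbacks C] {E B : C} (p : E ⟶ B) : Prop :=
  Nonempty (MonadicRightAdjoint (Over.pullback p))

/-- A central extension with respect to the (absolute) Galois structure of a reflection:
some pullback along an effective descent morphism is a trivial extension. -/
def IsCentralExt [HasPullbacks C] (R : Reflection C P) {A B : C} (f : A ⟶ B) : Prop :=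
  ∃ (E : C) (p : E ⟶ B), IsEffectiveDescent p ∧
    ∃ (Pb : C) (p1 : Pb ⟶ E) (p2 : Pb ⟶ A), IsPullback p1 p2 p f ∧ IsTrivialExt R p1

/-- A normal extension with respect to the (absolute) Galois structure of a reflection. -/
def IsNormalExt [HasPullbacks C] (R : Reflection C P) {A B : C} (f : A ⟶ B) : Prop :=
  IsEffectiveDescent f ∧
    ∃ (Pb : C) (p1 p2 : Pb ⟶ A), IsPullback p1 p2 f f ∧ IsTrivialExt R p1

/-- A central extension with respect to the Galois structure of a reflection relative to
the class of normal epimorphisms. -/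
def IsCentralExtN [HasZeroMorphisms C] (R : Reflection C P) {A B : C} (f : A ⟶ B) : Prop :=
  IsNormalEpiArrow f ∧ ∃ (E : C) (p : E ⟶ B), IsNormalEpiArrow p ∧
    ∃ (Pb : C) (p1 : Pb ⟶ E) (p2 : Pb ⟶ A), IsPullback p1 p2 p f ∧ IsTrivialExt R p1

/-- A normal extension with respect to the Galois structure of a reflection relative to
the class of normal epimorphisms. -/
def IsNormalExtN [HasZeroMorphisms C] (R : Reflection C P) {A B : C} (f : A ⟶ B) : Prop :=
  IsNormalEpiArrow f ∧
    ∃ (Pb : C) (p1 p2 : Pb ⟶ A), IsPullback p1 p2 f f ∧ IsTrivialExt R p1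

/-- The reflector is semi-left-exact: it preserves pullbacks of units along morphisms
with domain in the subcategory. -/
def SemiLeftExact (R : Reflection C P) : Prop :=
  ∀ ⦃A X Pb : C⦄ (x : X ⟶ R.F.obj A) (p1 : Pb ⟶ A) (p2 : Pb ⟶ X), P X →
    IsPullback p1 p2 (R.η.app A) x →
    IsPullback (R.F.map p1) (R.F.map p2) (R.F.map (R.η.app A)) (R.F.map x)

/-- The reflector has stable units: it preserves pullbacks of units along arbitrary
morphisms. -/
def StableUnits (R : Reflection C P) : Prop :=
  ∀ ⦃A X Pb : C⦄ (x : X ⟶ R.F.obj A) (p1 : Pb ⟶ A) (p2 : Pb ⟶ X),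
    IsPullback p1 p2 (R.η.app A) x →
    IsPullback (R.F.map p1) (R.F.map p2) (R.F.map (R.η.app A)) (R.F.map x)

/-- The reflection is admissible with respect to the class of normal epimorphisms:
the reflector preserves pullbacks of units along normal epimorphisms with domain in
the subcategory. -/
def AdmissibleN [HasZeroMorphisms C] (R : Reflection C P) : Prop :=
  ∀ ⦃A X Pb : C⦄ (x : X ⟶ R.F.obj A) (p1 : Pb ⟶ A) (p2 : Pb ⟶ X), P X →
    IsNormalEpiArrow x →
    IsPullback p1 p2 (R.η.app A) x →
    IsPullback (R.F.map p1) (R.F.map p2) (R.F.map (R.η.app A)) (R.F.map x)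

/-- The radical associated to a (normal epi)-reflection is idempotent. -/
def IdempotentRadical [HasZeroMorphisms C] (R : Reflection C P) : Prop :=
  ∀ ⦃A TA : C⦄ (t : TA ⟶ A), IsKernelOf t (R.η.app A) →
    ∀ ⦃T2 : C⦄ (t2 : T2 ⟶ TA), IsKernelOf t2 (R.η.app TA) → IsIso t2

/-- Condition (N) for a (normal epi)-reflection: for any morphism `f` with kernel
`k : K ⟶ A`, and any kernel `t : TK ⟶ K` of the unit at `K`, the composite `t ≫ k`
is a normal monomorphism. -/
def ConditionN [HasZeroMorphisms C] (R : Reflection C P) : Prop :=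
  ∀ ⦃A B : C⦄ (f : A ⟶ B) ⦃K : C⦄ (k : K ⟶ A), IsKernelOf k f →
    ∀ ⦃TK : C⦄ (t : TK ⟶ K), IsKernelOf t (R.η.app K) → IsNormalMonoArrow (t ≫ k)

/-- A torsion theory on a pointed category, given by a pair of full replete
subcategories. -/
structure TorsionTheory (C : Type u) [Category.{v} C] [HasZeroMorphisms C]
    (T F : C → Prop) : Prop where
  repleteT : Replete T
  repleteF : Replete F
  hom_zero : ∀ ⦃X Y : C⦄ (f : X ⟶ Y), T X → F Y → f = 0
  exists_ses : ∀ A : C, ∃ (TA FA : C) (t : TA ⟶ A) (q : A ⟶ FA),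
    T TA ∧ F FA ∧ IsShortExact t q

/-- Condition (N) for a torsion theory, formulated without reference to a chosen
reflector: for any morphism `f` with kernel `k : K ⟶ A` and any short exact sequence
`0 → TK → K → FK → 0` with `TK` torsion and `FK` torsion-free, the composite
`TK → A` is a normal monomorphism. -/
def TTConditionN [HasZeroMorphisms C] (T F : C → Prop) : Prop :=
  ∀ ⦃A B K TK FK : C⦄ (f : A ⟶ B) (k : K ⟶ A) (t : TK ⟶ K) (q : K ⟶ FK),
    IsKernelOf k f → T TK → F FK → IsShortExact t q → IsNormalMonoArrow (t ≫ k)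

/-- Condition (P) for a torsion theory: the torsion-free reflector is protoadditive
(formulated for every (normal epi)-reflection onto the torsion-free part). -/
def TTConditionP [HasZeroMorphisms C] (T F : C → Prop) : Prop :=
  ∀ R : Reflection C F, NormalEpiUnits R → IsProtoadditive R.F

/-- Orthogonality `e ↓ m` of two morphisms. -/
def Orthogonal {A B X Y : C} (e : A ⟶ B) (m : X ⟶ Y) : Prop :=
  ∀ (a : A ⟶ X) (b : B ⟶ Y), e ≫ b = a ≫ m →
    ∃! d : B ⟶ X, e ≫ d = a ∧ d ≫ m = b

/-- The class of morphisms orthogonal on the right to all members of `E`. -/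
def dnOrth (E : MorphismProperty C) : MorphismProperty C :=
  fun _ _ m => ∀ ⦃A B : C⦄ (e : A ⟶ B), E e → Orthogonal e m

/-- The class of morphisms orthogonal on the left to all members of `M`. -/
def upOrth (M : MorphismProperty C) : MorphismProperty C :=
  fun _ _ e => ∀ ⦃X Y : C⦄ (m : X ⟶ Y), M m → Orthogonal e m

/-- A prefactorisation system. -/
structure IsPrefactorisationSystem (E M : MorphismProperty C) : Prop where
  E_eq : E = upOrth M
  M_eq : M = dnOrth E

/-- A factorisation system. -/
structure IsFactorisationSystem (E M : MorphismProperty C) : Prop where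
  E_eq : E = upOrth M
  M_eq : M = dnOrth E
  fac : ∀ ⦃X Y : C⦄ (f : X ⟶ Y),
    ∃ (I : C) (e : X ⟶ I) (m : I ⟶ Y), E e ∧ M m ∧ e ≫ m = f

/-- A pullback-stable class of morphisms. -/
def PullbackStable (E : MorphismProperty C) : Prop :=
  ∀ ⦃P X Y Z : C⦄ (fst : P ⟶ X) (snd : P ⟶ Y) (f : X ⟶ Z) (g : Y ⟶ Z),
    IsPullback fst snd f g → E f → E snd

/-- The class of morphisms inverted by the reflector. -/
def invertedByR (R : Reflection C P) : MorphismProperty C :=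
  fun _ _ f => IsIso (R.F.map f)

/-- The class of morphisms all of whose pullbacks lie in `E` ("stably in `E`"). -/
def StablyIn (E : MorphismProperty C) : MorphismProperty C :=
  fun _ Y e => ∀ ⦃Pb W : C⦄ (fst : Pb ⟶ W) (snd : Pb ⟶ _) (g : W ⟶ Y),
    IsPullback fst snd g e → E fst

/-- The class of morphisms locally in `M`: some pullback along an effective descent
morphism lies in `M`. -/
def locallyIn [HasPullbacks C] (M : MorphismProperty C) : MorphismProperty C :=
  fun _ B f => ∃ (E : C) (p : E ⟶ B), IsEffectiveDescent p ∧
    ∃ (Pb : C) (p1 : Pb ⟶ E) (p2 : Pb ⟶ _), IsPullback p1 p2 p f ∧ M p1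

/-- The class `Ē` associated to a torsion theory: normal epimorphisms with torsion
kernel. -/
def Ebar [HasZeroMorphisms C] (T : C → Prop) : MorphismProperty C :=
  fun X _ e => IsNormalEpiArrow e ∧ ∃ (K : C) (k : K ⟶ X), IsKernelOf k e ∧ T K

/-- The class `M̄` associated to a torsion theory: morphisms with torsion-free
kernel. -/
def Mbar [HasZeroMorphisms C] (F : C → Prop) : MorphismProperty C :=
  fun X _ m => ∃ (K : C) (k : K ⟶ X), IsKernelOf k m ∧ F K

/-- A Birkhoff subcategory: a (regular epi)-reflective subcategory such that the
naturality squares of the unit at regular epimorphisms are pushouts. -/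
structure IsBirkhoff [HasZeroMorphisms C] (R : Reflection C P) : Prop where
  units_regEpi : ∀ X : C, Nonempty (RegularEpi (R.η.app X))
  pushout_units : ∀ ⦃A B : C⦄ (f : A ⟶ B), Nonempty (RegularEpi f) →
    IsPushout f (R.η.app A) (R.η.app B) (R.F.map f)

section ArrowInstances

variable [HasZeroMorphisms C]

instance instZeroArrowHom (f g : Arrow C) : Zero (f ⟶ g) :=
  ⟨{ left := 0, right := 0, w := by simp }⟩

@[simp] lemma arrowHomZero_left (f g : Arrow C) : (0 : f ⟶ g).left = 0 := rfl

@[simp] lemma arrowHomZero_right (f g : Arrow C) : (0 : f ⟶ g).right = 0 := rfl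

instance instArrowHasZeroMorphisms : HasZeroMorphisms (Arrow C) where
  comp_zero {X Y} f Z := by
    apply CommaMorphism.ext <;> simp
  zero_comp X {Y Z} f := by
    apply CommaMorphism.ext <;> simp

end ArrowInstances

section Helpers

variable [HasZeroMorphisms C]

lemma IsKernelOf.lift {K A B : C} {k : K ⟶ A} {f : A ⟶ B} (h : IsKernelOf k f)
    {Z : C} (z : Z ⟶ A) (hz : z ≫ f = 0) : ∃ l : Z ⟶ K, l ≫ k = z := by
  obtain ⟨w, ⟨hl⟩⟩ := h
  exact ⟨hl.lift (KernelFork.ofι z hz), hl.fac (KernelFork.ofι z hz) WalkingParallelPair.zero⟩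

lemma IsKernelOf.mono {K A B : C} {k : K ⟶ A} {f : A ⟶ B} (h : IsKernelOf k f) : Mono k := by
  obtain ⟨w, ⟨hl⟩⟩ := h
  exact ⟨fun a b hab => Fork.IsLimit.hom_ext hl hab⟩

lemma isKernelOf_mk {K A B : C} {k : K ⟶ A} {f : A ⟶ B} (w : k ≫ f = 0) [Mono k]
    (h : ∀ ⦃Z : C⦄ (z : Z ⟶ A), z ≫ f = 0 → ∃ l : Z ⟶ K, l ≫ k = z) : IsKernelOf k f := by
  refine ⟨w, ⟨KernelFork.IsLimit.ofι' k w fun {Z} z hz => ⟨(h z hz).choose, (h z hz).choose_spec⟩⟩⟩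

lemma IsCokernelOf.regEpi {K A B : C} {k : K ⟶ A} {f : A ⟶ B} (h : IsCokernelOf f k) :
    Nonempty (RegularEpi f) := by
  obtain ⟨w, ⟨hl⟩⟩ := h
  exact ⟨{ W := K, left := k, right := 0, w := by simpa using w, isColimit := hl }⟩

lemma regEpi_epi {A B : C} {f : A ⟶ B} (h : Nonempty (RegularEpi f)) : Epi f := by
  obtain ⟨h⟩ := h
  exact ⟨fun a b hab => Cofork.IsColimit.hom_ext h.isColimit hab⟩

lemma mono_of_trivial_kernel [HasZeroObject C] (hC : IsHomological C) {X Y : C} (u : X ⟶ Y)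
    (h : ∀ ⦃Z : C⦄ (z : Z ⟶ X), z ≫ u = 0 → z = 0) : Mono u := by
  have := hC.hasFiniteLimits
  open ZeroObject in
  have hz : IsZero (0 : C) := isZero_zero C
  have m1 : ∀ {W : C}, Mono (0 : (HasZeroObject.zero' C).zero ⟶ W) :=
    fun {W} => ⟨fun a b _ => hz.eq_of_tgt a b⟩
  obtain ⟨d, hd1, hd2⟩ : ∃ d : X ⟶ pullback u u,
      d ≫ pullback.fst u u = 𝟙 X ∧ d ≫ pullback.snd u u = 𝟙 X :=
    ⟨pullback.lift (𝟙 X) (𝟙 X) rfl, pullback.lift_fst _ _ _, pullback.lift_snd _ _ _⟩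
  have hiso := hC.protomodular (0 : (HasZeroObject.zero' C).zero ⟶ X) (𝟙 X) (𝟙 X)
    (0 : (HasZeroObject.zero' C).zero ⟶ pullback u u) (pullback.fst u u)
    d (𝟙 _) d (𝟙 X)
    ⟨by
      have := m1 (W := X)
      exact isKernelOf_mk (by simp) fun Z z hz => ⟨0, by simpa using hz.symm⟩, by simp⟩
    ⟨by
      have := m1 (W := pullback u u)
      refine isKernelOf_mk (by simp) fun Z z hz => ⟨0, ?_⟩
      have h2 : z ≫ pullback.snd u u = 0 := by
        apply h
        rw [Category.assoc, ← pullback.condition, ← Category.assoc, hz, zero_comp]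
      apply pullback.hom_ext
      · simp [hz]
      · simp [h2], hd1⟩
    (by simp) (by simp [hd1]) (by simp) inferInstance inferInstance
  have hfs : pullback.fst u u = pullback.snd u u := by
    rw [← cancel_epi d, hd1, hd2]
  refine ⟨fun a b hab => ?_⟩
  have h1 := pullback.lift_fst (f := u) (g := u) a b hab
  have h2 := pullback.lift_snd (f := u) (g := u) a b hab
  rw [hfs] at h1
  exact h1.symm.trans h2

end Helpers

/-- Theorem 2.5. Let `(T, F)` be a torsion theory in a homological
category. Then the torsion part `T` is hereditary with respect to protosplit
monomorphisms if and only if the torsion-free reflector is protoadditive. -/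
theorem statement3 {C : Type u} [Category.{v} C] [HasZeroObject C] [HasZeroMorphisms C]
    (hC : IsHomological C) {Tp Fp : C → Prop} (tt : TorsionTheory C Tp Fp)
    (R : Reflection C Fp)
    (hR : ∀ X : C, ∃ (K : C) (k : K ⟶ X), Tp K ∧ IsShortExact k (R.η.app X)) :
    (∀ ⦃A B : C⦄ (m : A ⟶ B), IsProtosplitMono m → Tp B → Tp A) ↔
      IsProtoadditive R.F := by
  have := hC.hasFiniteLimits
  have hreg : ∀ X : C, Nonempty (RegularEpi (R.η.app X)) := fun X => by
    obtain ⟨K, k, _, h⟩ := hR X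
    exact h.isCokernel.regEpi
  have hepi : ∀ X : C, Epi (R.η.app X) := fun X => regEpi_epi (hreg X)
  have nat : ∀ {X Y : C} (g : X ⟶ Y), g ≫ R.η.app Y = R.η.app X ≫ R.F.map g :=
    fun g => R.η.naturality g
  constructor
  · intro her K A B k f s hs
    have hkm : Mono k := hs.isKernel.mono
    have hkf : k ≫ f = 0 := hs.isKernel.1
    obtain ⟨TA, tA, hTA, eA⟩ := hR A
    obtain ⟨TB, tB, hTB, eB⟩ := hR B
    have mA : Mono tA := eA.isKernel.mono
    have mB : Mono tB := eB.isKernel.mono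
    have tA0 : tA ≫ R.η.app A = 0 := eA.isKernel.1
    have tB0 : tB ≫ R.η.app B = 0 := eB.isKernel.1
    have hFF : R.F.map k ≫ R.F.map f = 0 := by
      have := hepi K
      rw [← cancel_epi (R.η.app K), ← Category.assoc, ← nat k, Category.assoc, ← nat f,
        ← Category.assoc, hkf]
      simp
    refine ⟨?_, by rw [← R.F.map_comp, hs.split, R.F.map_id]⟩
    -- the torsion part of the sequence
    obtain ⟨Tf, hTf⟩ := eB.isKernel.lift (tA ≫ f) (by
      rw [Category.assoc, nat f, ← Category.assoc, tA0, zero_comp])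
    obtain ⟨Ts, hTs⟩ := eA.isKernel.lift (tB ≫ s) (by
      rw [Category.assoc, nat s, ← Category.assoc, tB0, zero_comp])
    have hsplit : Ts ≫ Tf = 𝟙 TB := by
      rw [← cancel_mono tB, Category.assoc, hTf, ← Category.assoc, hTs, Category.assoc, hs.split]
      simp
    have hker : IsKernelOf (kernel.ι Tf) Tf :=
      isKernelOf_mk (kernel.condition Tf) fun Z z hz => ⟨kernel.lift Tf z hz, by simp⟩
    have hN : Tp (kernel Tf) := her (kernel.ι Tf) ⟨TB, Tf, Ts, hker, hsplit⟩ hTA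
    obtain ⟨m, hm⟩ := hs.isKernel.lift (kernel.ι Tf ≫ tA) (by
      rw [Category.assoc, ← hTf, ← Category.assoc, kernel.condition, zero_comp])
    have hm0 : m ≫ R.η.app K = 0 := tt.hom_zero _ hN (R.mem K)
    -- `F k` is a monomorphism
    have hmono : Mono (R.F.map k) := by
      apply mono_of_trivial_kernel hC
      intro W w hw
      have hp := (IsPullback.of_hasPullback (R.η.app K) w)
      have := regEpi_epi (hC.regEpiStable _ _ _ _ hp (hreg K))
      set q := pullback.fst (R.η.app K) w with hq
      have hcond : q ≫ R.η.app K = pullback.snd (R.η.app K) w ≫ w := pullback.condition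
      obtain ⟨a, ha⟩ := eA.isKernel.lift (q ≫ k) (by
        rw [Category.assoc, nat k, ← Category.assoc, hcond, Category.assoc, hw, comp_zero])
      have haf : a ≫ Tf = 0 := by
        rw [← cancel_mono tB, Category.assoc, hTf, ← Category.assoc, ha, Category.assoc, hkf]
        simp
      have hqm : q = kernel.lift Tf a haf ≫ m := by
        rw [← cancel_mono k, Category.assoc, hm, ← Category.assoc, kernel.lift_ι, ha]
      rw [← cancel_epi (pullback.snd (R.η.app K) w), ← hcond, hqm, Category.assoc, hm0]
      simp
    -- objects of the comparison
    let l := kernel.ι (R.F.map f)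
    let a := pullback.fst (R.η.app A) l
    let e := pullback.snd (R.η.app A) l
    have hae : a ≫ R.η.app A = e ≫ l := pullback.condition
    have hlf : l ≫ R.F.map f = 0 := kernel.condition _
    have hextA : ∀ {Z : C} (x y : Z ⟶ pullback (R.η.app A) l), x ≫ a = y ≫ a → x = y := by
      intro Z x y hxy
      apply pullback.hom_ext hxy
      rw [← cancel_mono l]
      change (x ≫ e) ≫ l = (y ≫ e) ≫ l
      rw [Category.assoc, Category.assoc, ← hae, ← Category.assoc, hxy, Category.assoc]
    have liftA : ∀ {Z : C} (x : Z ⟶ A), x ≫ f ≫ R.η.app B = 0 →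
        ∃ y : Z ⟶ pullback (R.η.app A) l, y ≫ a = x := by
      intro Z x hx
      rw [nat f] at hx
      exact ⟨pullback.lift x (kernel.lift (R.F.map f) (x ≫ R.η.app A)
        (by rw [Category.assoc]; exact hx)) (by simp [l]), pullback.lift_fst _ _ _⟩
    let j1 := pullback.fst (R.η.app A) (R.F.map k)
    let j2 := pullback.snd (R.η.app A) (R.F.map k)
    have hj : j1 ≫ R.η.app A = j2 ≫ R.F.map k := pullback.condition
    have hextJ : ∀ {Z : C} (x y : Z ⟶ pullback (R.η.app A) (R.F.map k)),
        x ≫ j1 = y ≫ j1 → x = y := by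
      intro Z x y hxy
      apply pullback.hom_ext hxy
      rw [← cancel_mono (R.F.map k)]
      change (x ≫ j2) ≫ _ = (y ≫ j2) ≫ _
      rw [Category.assoc, Category.assoc, ← hj, ← Category.assoc, hxy, Category.assoc]
    obtain ⟨α, hα⟩ := liftA j1 (by
      rw [nat f, ← Category.assoc, hj, Category.assoc, hFF, comp_zero])
    obtain ⟨p, hp⟩ := eB.isKernel.lift (a ≫ f) (by
      rw [Category.assoc, nat f, ← Category.assoc, hae, Category.assoc, hlf, comp_zero])
    obtain ⟨σ, hσ⟩ := liftA (tB ≫ s) (by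
      rw [Category.assoc, ← Category.assoc s, hs.split, Category.id_comp, tB0])
    obtain ⟨κ, hκ⟩ := liftA k (by rw [← Category.assoc, hkf, zero_comp])
    obtain ⟨σ', hσ'⟩ : ∃ y : TB ⟶ pullback (R.η.app A) (R.F.map k), y ≫ j1 = tB ≫ s :=
      ⟨pullback.lift (tB ≫ s) 0 (by
        rw [Category.assoc, nat s, ← Category.assoc, tB0, zero_comp, zero_comp]),
        pullback.lift_fst _ _ _⟩
    obtain ⟨κ', hκ'⟩ : ∃ y : K ⟶ pullback (R.η.app A) (R.F.map k), y ≫ j1 = k :=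
      ⟨pullback.lift k (R.η.app K) (nat k), pullback.lift_fst _ _ _⟩
    have mκ : Mono κ := by
      have : Mono (κ ≫ a) := by rw [hκ]; exact hkm
      exact mono_of_mono κ a
    have mκ' : Mono κ' := by
      have : Mono (κ' ≫ j1) := by rw [hκ']; exact hkm
      exact mono_of_mono κ' j1
    have hκα : κ' ≫ α = κ := hextA _ _ (by rw [Category.assoc, hα, hκ', hκ])
    have hσα : σ' ≫ α = σ := hextA _ _ (by rw [Category.assoc, hα, hσ', hσ])
    have hσp : σ ≫ p = 𝟙 TB := by
      rw [← cancel_mono tB, Category.assoc, hp, ← Category.assoc, hσ, Category.assoc, hs.split]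
      simp
    have hκp : κ ≫ p = 0 := by
      rw [← cancel_mono tB, Category.assoc, hp, ← Category.assoc, hκ, hkf]
      simp
    have hiso : IsIso α := by
      refine hC.protomodular κ' (α ≫ p) σ' κ p σ (𝟙 K) α (𝟙 TB) ⟨?_, ?_⟩ ⟨?_, hσp⟩
        (by simpa using hκα) (by simp) (by simpa using hσα) inferInstance inferInstance
      · refine isKernelOf_mk (by rw [← Category.assoc, hκα, hκp]) fun Z z hz => ?_
        obtain ⟨y, hy⟩ := hs.isKernel.lift (z ≫ j1) (by
          rw [← hα, Category.assoc, Category.assoc, ← hp, ← Category.assoc α, ← Category.assoc z,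
            hz, zero_comp])
        exact ⟨y, hextJ _ _ (by rw [Category.assoc, hκ', hy])⟩
      · rw [← Category.assoc, hσα, hσp]
      · refine isKernelOf_mk hκp fun Z z hz => ?_
        obtain ⟨y, hy⟩ := hs.isKernel.lift (z ≫ a) (by
          rw [Category.assoc, ← hp, ← Category.assoc, hz, zero_comp])
        exact ⟨y, hextA _ _ (by rw [Category.assoc, hκ, hy])⟩
    have hereg : Nonempty (RegularEpi e) :=
      hC.regEpiStable _ _ _ _ (IsPullback.of_hasPullback (R.η.app A) l) (hreg A)
    have heepi := regEpi_epi hereg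
    obtain ⟨he⟩ := hereg
    have hd : (inv α ≫ j2) ≫ R.F.map k = e ≫ l := by
      rw [Category.assoc, ← hj, ← hα, ← hae]
      simp
    obtain ⟨v, hv⟩ : ∃ v : kernel (R.F.map f) ⟶ R.F.obj K, e ≫ v = inv α ≫ j2 := by
      have hw : he.left ≫ inv α ≫ j2 = he.right ≫ inv α ≫ j2 := by
        rw [← cancel_mono (R.F.map k), Category.assoc, Category.assoc he.right, hd,
          ← Category.assoc, he.w, Category.assoc]
      exact ⟨Cofork.IsColimit.desc he.isColimit _ hw, Cofork.IsColimit.π_desc' he.isColimit _ hw⟩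
    have hvl : v ≫ R.F.map k = l := by
      rw [← cancel_epi e, ← Category.assoc, hv, hd]
    refine isKernelOf_mk hFF fun Z z hz => ⟨kernel.lift _ z hz ≫ v, ?_⟩
    rw [Category.assoc, hvl]
    exact kernel.lift_ι _ _ _
  · rintro hF A B m ⟨X, f, s, hs⟩ hB
    have hm := (hF m f s hs).isKernel.mono
    have hηB : R.η.app B = 0 := tt.hom_zero _ hB (R.mem B)
    have hηA : R.η.app A = 0 := by
      rw [← cancel_mono (R.F.map m), ← nat m, hηB]
      simp
    obtain ⟨K, k, hK, h⟩ := hR A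
    have hkm : Mono k := h.isKernel.mono
    obtain ⟨y, hy⟩ := h.isKernel.lift (𝟙 A) (by rw [hηA]; simp)
    exact tt.repleteT hK ⟨k, y, by rw [← cancel_mono k, Category.assoc, hy]; simp, hy⟩

end ProtoPaper
end

section
/- Let A be a semi-abelian category and F : A → F a protoadditive reflector onto a full replete (normal epi)-reflective subcategory F of A. Then F is a torsion-free subcategory of A (the torsion-free part of some torsion theory in A) if and only if F is closed under extensions in A: for every short exact sequence 0 → K → A → B → 0 with K ∈ F and B ∈ F, one has A ∈ F. -/
open CategoryTheory CategoryTheory.Limits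

universe v u v₂ u₂

namespace ProtoPaper

variable {C : Type u} [Category.{v} C]

variable {P : C → Prop}

section Aux

variable [HasZeroMorphisms C]

lemma IsKernelOf.exists_lift {K A B : C} {k : K ⟶ A} {f : A ⟶ B} (h : IsKernelOf k f)
    {Z : C} (x : Z ⟶ A) (hx : x ≫ f = 0) : ∃ l : Z ⟶ K, l ≫ k = x := by
  obtain ⟨w, ⟨hl⟩⟩ := h
  exact ⟨hl.lift (KernelFork.ofι x hx), hl.fac (KernelFork.ofι x hx) WalkingParallelPair.zero⟩

lemma IsKernelOf.mk' {K A B : C} {k : K ⟶ A} {f : A ⟶ B} (w : k ≫ f = 0)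
    (hm : Mono k) (h : ∀ ⦃Z : C⦄ (x : Z ⟶ A), x ≫ f = 0 → ∃ l : Z ⟶ K, l ≫ k = x) :
    IsKernelOf k f := by
  refine ⟨w, ⟨KernelFork.IsLimit.ofι k w (fun x hx => (h x hx).choose)
    (fun x hx => (h x hx).choose_spec) ?_⟩⟩
  intro Z x hx m hm'
  rw [← cancel_mono k, hm', (h x hx).choose_spec]

lemma IsCokernelOf.exists_desc {K A B : C} {k : K ⟶ A} {f : A ⟶ B} (h : IsCokernelOf f k)
    {Z : C} (x : A ⟶ Z) (hx : k ≫ x = 0) : ∃ l : B ⟶ Z, f ≫ l = x := by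
  obtain ⟨w, ⟨hl⟩⟩ := h
  exact ⟨hl.desc (CokernelCofork.ofπ x hx),
    hl.fac (CokernelCofork.ofπ x hx) WalkingParallelPair.one⟩

lemma IsCokernelOf.epi {K A B : C} {k : K ⟶ A} {f : A ⟶ B} (h : IsCokernelOf f k) : Epi f := by
  obtain ⟨w, ⟨hl⟩⟩ := h
  exact ⟨fun a b hab => Cofork.IsColimit.hom_ext hl hab⟩

lemma IsCokernelOf.mk' {K A B : C} {k : K ⟶ A} {f : A ⟶ B} (w : k ≫ f = 0)
    (hm : Epi f) (h : ∀ ⦃Z : C⦄ (x : A ⟶ Z), k ≫ x = 0 → ∃ l : B ⟶ Z, f ≫ l = x) :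
    IsCokernelOf f k := by
  refine ⟨w, ⟨CokernelCofork.IsColimit.ofπ f w (fun x hx => (h x hx).choose)
    (fun x hx => (h x hx).choose_spec) ?_⟩⟩
  intro Z x hx m hm'
  rw [← cancel_epi f, hm', (h x hx).choose_spec]

lemma exists_kernelOf [HasFiniteLimits C] {A B : C} (f : A ⟶ B) :
    ∃ (K : C) (k : K ⟶ A), IsKernelOf k f :=
  ⟨kernel f, kernel.ι f, IsKernelOf.mk' (kernel.condition f) inferInstance
    fun _ x hx => ⟨kernel.lift f x hx, kernel.lift_ι f x hx⟩⟩

/-- A normal epimorphism is the cokernel of its kernel. -/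
lemma IsNormalEpiArrow.isCokernelOf {K A B : C} {k : K ⟶ A} {f : A ⟶ B}
    (h : IsNormalEpiArrow f) (hk : IsKernelOf k f) : IsCokernelOf f k := by
  obtain ⟨M, m, hm⟩ := h
  obtain ⟨l, hl⟩ := hk.exists_lift m hm.1
  refine IsCokernelOf.mk' hk.1 hm.epi fun Z x hx => hm.exists_desc x ?_
  rw [← hl, Category.assoc, hx, comp_zero]

/-- Kernels of pullback projections. -/
lemma isKernelOf_fst {Q X Y Z K : C} {fst : Q ⟶ X} {snd : Q ⟶ Y} {f : X ⟶ Z} {g : Y ⟶ Z}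
    (hp : IsPullback fst snd f g) {k : K ⟶ Y} (hk : IsKernelOf k g) {j : K ⟶ Q}
    (h1 : j ≫ fst = 0) (h2 : j ≫ snd = k) : IsKernelOf j fst := by
  have := hk.mono
  refine IsKernelOf.mk' h1 ?_ ?_
  · have : Mono (j ≫ snd) := by rw [h2]; infer_instance
    exact mono_of_mono j snd
  · intro W x hx
    obtain ⟨l, hl⟩ := hk.exists_lift (x ≫ snd) (by
      rw [Category.assoc, ← hp.w, ← Category.assoc, hx, zero_comp])
    refine ⟨l, hp.hom_ext ?_ ?_⟩
    · rw [Category.assoc, h1, hx, comp_zero]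
    · rw [Category.assoc, h2, hl]

/-- In a split short exact sequence the kernel and the section are jointly epic. -/
lemma IsSplitShortExact.hom_ext [HasFiniteLimits C] (hC : IsProtomodular C) {K A B : C}
    {k : K ⟶ A} {f : A ⟶ B} {s : B ⟶ A} (h : IsSplitShortExact k f s) {Z : C} {x y : A ⟶ Z}
    (hk : k ≫ x = k ≫ y) (hs : s ≫ x = s ≫ y) : x = y := by
  have hm := h.isKernel.mono
  have h' : IsSplitShortExact (equalizer.lift k hk) (equalizer.ι x y ≫ f)
      (equalizer.lift s hs) := by
    refine ⟨IsKernelOf.mk' ?_ ?_ ?_, ?_⟩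
    · rw [equalizer.lift_ι_assoc, h.isKernel.1]
    · have : Mono (equalizer.lift k hk ≫ equalizer.ι x y) := by
        rw [equalizer.lift_ι]; infer_instance
      exact mono_of_mono _ (equalizer.ι x y)
    · intro W z hz
      obtain ⟨l, hl⟩ := h.isKernel.exists_lift (z ≫ equalizer.ι x y) (by simpa using hz)
      refine ⟨l, ?_⟩
      rw [← cancel_mono (equalizer.ι x y), Category.assoc, equalizer.lift_ι, hl]
    · rw [equalizer.lift_ι_assoc, h.split]
  have := hC _ _ _ k f s (𝟙 K) (equalizer.ι x y) (𝟙 B) h' h (by simp) (by simp) (by simp)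
    inferInstance inferInstance
  rw [← cancel_epi (equalizer.ι x y)]
  exact equalizer.condition x y

/-- Regular epimorphisms are normal in a pointed protomodular category. -/
lemma isNormalEpiArrow_of_regularEpi [HasFiniteLimits C] (hC : IsProtomodular C) {A B : C}
    (f : A ⟶ B) (hf : Nonempty (RegularEpi f)) : IsNormalEpiArrow f := by
  obtain ⟨r⟩ := hf
  obtain ⟨K, k, hk⟩ := exists_kernelOf f
  have hepi : Epi f := ⟨fun a b hab => Cofork.IsColimit.hom_ext r.isColimit hab⟩
  refine ⟨K, k, IsCokernelOf.mk' hk.1 hepi fun Z x hx => ?_⟩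
  have hp := IsPullback.of_hasPullback f f
  have hj : IsSplitShortExact (hp.lift 0 k (by rw [zero_comp, hk.1])) (pullback.fst f f)
      (hp.lift (𝟙 A) (𝟙 A) rfl) :=
    ⟨isKernelOf_fst hp hk (by simp) (by simp), by simp⟩
  have e : pullback.fst f f ≫ x = pullback.snd f f ≫ x := by
    apply hj.hom_ext hC
    · rw [← Category.assoc, ← Category.assoc, hp.lift_fst, hp.lift_snd, hx, zero_comp]
    · rw [← Category.assoc, ← Category.assoc, hp.lift_fst, hp.lift_snd]
  have e2 : r.left ≫ x = r.right ≫ x := by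
    have := congrArg (fun z => hp.lift r.left r.right r.w ≫ z) e
    simpa only [← Category.assoc, hp.lift_fst, hp.lift_snd] using this
  exact ⟨r.isColimit.desc (Cofork.ofπ x e2),
    r.isColimit.fac (Cofork.ofπ x e2) WalkingParallelPair.one⟩

/-- Condition (N): there is a regular epimorphism on `A` whose kernel is `T(K) → K → A`,
and through which `f` factors. -/
lemma exists_quotient [HasZeroObject C] (hC : IsSemiAbelian C) (R : Reflection C P)
    (hproto : IsProtoadditive R.F) {K A B TK : C} {k : K ⟶ A} {f : A ⟶ B}
    (hk : IsKernelOf k f) {t : TK ⟶ K} (ht : IsKernelOf t (R.η.app K)) :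
    ∃ (Y : C) (g : A ⟶ Y) (h : Y ⟶ B), Nonempty (RegularEpi g) ∧ g ≫ h = f ∧
      IsKernelOf (t ≫ k) g := by
  have := hC.homological.hasFiniteLimits
  have hkm := hk.mono
  have htm := ht.mono
  obtain ⟨E, p₁, p₂, hp⟩ : ∃ (E : C) (p₁ p₂ : E ⟶ A), IsPullback p₁ p₂ f f :=
    ⟨_, _, _, IsPullback.of_hasPullback f f⟩
  -- diagonal, kernel of first projection
  obtain ⟨δ, hδ₁, hδ₂⟩ : ∃ δ : A ⟶ E, δ ≫ p₁ = 𝟙 A ∧ δ ≫ p₂ = 𝟙 A :=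
    ⟨hp.lift (𝟙 A) (𝟙 A) rfl, by simp, by simp⟩
  obtain ⟨σ, hσ₁, hσ₂⟩ : ∃ σ : E ⟶ E, σ ≫ p₁ = p₂ ∧ σ ≫ p₂ = p₁ :=
    ⟨hp.lift p₂ p₁ hp.w.symm, by simp, by simp⟩
  obtain ⟨j, hj₁, hj₂⟩ : ∃ j : K ⟶ E, j ≫ p₁ = 0 ∧ j ≫ p₂ = k :=
    ⟨hp.lift 0 k (by rw [zero_comp, hk.1]), by simp, by simp⟩
  have hj : IsKernelOf j p₁ := isKernelOf_fst hp hk hj₁ hj₂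
  have hF := hproto _ _ _ ⟨hj, hδ₁⟩
  have hFjm := hF.isKernel.mono
  -- triples
  obtain ⟨E₃, a, b, hq⟩ : ∃ (E₃ : C) (a b : E₃ ⟶ E), IsPullback a b p₂ p₁ :=
    ⟨_, _, _, IsPullback.of_hasPullback p₂ p₁⟩
  obtain ⟨c, hc₁, hc₂⟩ : ∃ c : E₃ ⟶ E, c ≫ p₁ = a ≫ p₁ ∧ c ≫ p₂ = b ≫ p₂ :=
    ⟨hp.lift (a ≫ p₁) (b ≫ p₂) (by
      rw [Category.assoc, hp.w, ← Category.assoc, hq.w, Category.assoc, hp.w, Category.assoc]),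
      by simp, by simp⟩
  obtain ⟨δ₃, hδa, hδb⟩ : ∃ d : A ⟶ E₃, d ≫ a = δ ∧ d ≫ b = δ :=
    ⟨hq.lift δ δ (by rw [hδ₁, hδ₂]), by simp, by simp⟩
  obtain ⟨j₃, hja, hjb⟩ : ∃ d : K ⟶ E₃, d ≫ a = 0 ∧ d ≫ b = j :=
    ⟨hq.lift 0 j (by rw [hj₁, zero_comp]), by simp, by simp⟩
  obtain ⟨s₃, hsa, hsb⟩ : ∃ d : E ⟶ E₃, d ≫ a = 𝟙 E ∧ d ≫ b = p₂ ≫ δ :=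
    ⟨hq.lift (𝟙 E) (p₂ ≫ δ) (by rw [Category.assoc, hδ₁]; simp), by simp, by simp⟩
  have hF₃ := hproto _ _ _ ⟨isKernelOf_fst hq hj hja hjb, hsa⟩
  have hδc : δ₃ ≫ c = δ := by
    apply hp.hom_ext
    · rw [Category.assoc, hc₁, ← Category.assoc, hδa]
    · rw [Category.assoc, hc₂, ← Category.assoc, hδb]
  -- joint monicity
  have hjm : ∀ ⦃Z : C⦄ (x y : Z ⟶ R.F.obj E₃), x ≫ R.F.map a = y ≫ R.F.map a →
      x ≫ R.F.map b = y ≫ R.F.map b → x = y := by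
    have hQ := IsPullback.of_hasPullback (R.F.map p₂) (R.F.map p₁)
    have hQs : IsSplitShortExact (hQ.lift 0 (R.F.map j) (by rw [zero_comp, hF.isKernel.1]))
        (pullback.fst (R.F.map p₂) (R.F.map p₁))
        (hQ.lift (𝟙 _) (R.F.map p₂ ≫ R.F.map δ) (by
          rw [Category.assoc, ← R.F.map_comp δ, hδ₁]; simp)) :=
      ⟨isKernelOf_fst hQ hF.isKernel (by simp) (by simp), by simp⟩
    have hw : R.F.map a ≫ R.F.map p₂ = R.F.map b ≫ R.F.map p₁ := by
      rw [← R.F.map_comp, ← R.F.map_comp, hq.w]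
    have hiso : IsIso (hQ.lift (R.F.map a) (R.F.map b) hw) := by
      refine hC.homological.protomodular _ _ _ _ _ _ (𝟙 _) _ (𝟙 _) hF₃ hQs ?_ (by simp) ?_
        inferInstance inferInstance
      · apply hQ.hom_ext
        · simp [hF₃.isKernel.1]
        · simp [← R.F.map_comp, hjb]
      · apply hQ.hom_ext
        · rw [Category.assoc, hQ.lift_fst, ← R.F.map_comp, hsa, Category.id_comp, hQ.lift_fst,
            R.F.map_id]
        · rw [Category.assoc, hQ.lift_snd, ← R.F.map_comp, hsb, Category.id_comp, hQ.lift_snd,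
            R.F.map_comp]
    intro Z x y hx hy
    rw [← cancel_mono (hQ.lift (R.F.map a) (R.F.map b) hw)]
    apply hQ.hom_ext <;> simpa
  have nat : ∀ {X Y : C} (u : X ⟶ Y), u ≫ R.η.app Y = R.η.app X ≫ R.F.map u :=
    fun u => R.η.naturality u
  -- the relation
  have hS : ∃ (S : C) (i : S ⟶ E), Mono i ∧
      i ≫ R.η.app E = i ≫ p₁ ≫ R.η.app A ≫ R.F.map δ ∧
      ∀ ⦃Z : C⦄ (x : Z ⟶ E), x ≫ R.η.app E = x ≫ p₁ ≫ R.η.app A ≫ R.F.map δ →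
        ∃ l : Z ⟶ S, l ≫ i = x :=
    ⟨equalizer (R.η.app E) (p₁ ≫ R.η.app A ≫ R.F.map δ), equalizer.ι _ _, inferInstance,
      equalizer.condition _ _, fun Z x hx => ⟨equalizer.lift x hx, equalizer.lift_ι x hx⟩⟩
  obtain ⟨S, i, him, hi, hlift⟩ := hS
  have hi₂ : i ≫ p₂ ≫ R.η.app A = i ≫ p₁ ≫ R.η.app A := by
    have := congrArg (fun z => z ≫ R.F.map p₂) hi
    simp only [Category.assoc, ← nat, reassoc_of% hδ₂] at this
    exact this
  have hEq : IsInternalEquivRel (i ≫ p₁) (i ≫ p₂) := by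
    refine ⟨?_, ?_, ?_, ?_⟩
    · intro Z x y h1 h2
      rw [← cancel_mono i]
      apply hp.hom_ext <;> simpa
    · obtain ⟨l, hl⟩ := hlift δ (by rw [reassoc_of% hδ₁, nat])
      exact ⟨l, by rw [reassoc_of% hl, hδ₁], by rw [reassoc_of% hl, hδ₂]⟩
    · have hδσ : δ ≫ σ = δ := by
        apply hp.hom_ext
        · rw [Category.assoc, hσ₁, hδ₁, hδ₂]
        · rw [Category.assoc, hσ₂, hδ₁, hδ₂]
      obtain ⟨l, hl⟩ := hlift (i ≫ σ) (by
        rw [Category.assoc, nat, reassoc_of% hi, ← R.F.map_comp, hδσ, Category.assoc,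
          reassoc_of% hσ₁, reassoc_of% hi₂])
      exact ⟨l, by rw [reassoc_of% hl, hσ₁], by rw [reassoc_of% hl, hσ₂]⟩
    · intro Q q₁ q₂ hQ
      have hw : q₁ ≫ i ≫ p₂ = q₂ ≫ i ≫ p₁ := hQ.w
      obtain ⟨w, hwa, hwb⟩ : ∃ w : Q ⟶ E₃, w ≫ a = q₁ ≫ i ∧ w ≫ b = q₂ ≫ i :=
        ⟨hq.lift (q₁ ≫ i) (q₂ ≫ i) (by simpa using hw), by simp, by simp⟩
      have key : w ≫ R.η.app E₃ = w ≫ a ≫ p₁ ≫ R.η.app A ≫ R.F.map δ₃ := by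
        apply hjm
        · simp only [Category.assoc, ← nat, reassoc_of% hδa]
          rw [reassoc_of% hwa, reassoc_of% hwa, hi, nat]
        · simp only [Category.assoc, ← nat, reassoc_of% hδb]
          rw [reassoc_of% hwb, reassoc_of% hwa, hi, ← reassoc_of% hw, reassoc_of% hi₂, nat]
      obtain ⟨l, hl⟩ := hlift (w ≫ c) (by
        rw [Category.assoc, nat, reassoc_of% key, ← R.F.map_comp, hδc, Category.assoc,
          reassoc_of% hc₁])
      refine ⟨l, ?_, ?_⟩
      · rw [reassoc_of% hl, hc₁, reassoc_of% hwa]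
      · rw [reassoc_of% hl, hc₂, reassoc_of% hwb]
  obtain ⟨Y₀, g₀, hg₀⟩ := hC.equivRelEffective _ _ hEq
  obtain ⟨Y, g, m, hg, hm, hgm⟩ := hC.homological.regEpiMonoFac g₀
  have hg₁ : i ≫ p₁ ≫ g = i ≫ p₂ ≫ g := by
    rw [← cancel_mono m]
    simpa [hgm] using hg₀.w
  have hg₂ : ∀ ⦃Z : C⦄ (x y : Z ⟶ A), x ≫ g = y ≫ g →
      ∃ l : Z ⟶ S, l ≫ i ≫ p₁ = x ∧ l ≫ i ≫ p₂ = y := by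
    intro Z x y hxy
    have : x ≫ g₀ = y ≫ g₀ := by rw [← hgm, reassoc_of% hxy]
    exact ⟨hg₀.lift x y this, hg₀.lift_fst x y this, hg₀.lift_snd x y this⟩
  have hh : ∃ h : Y ⟶ B, g ≫ h = f := by
    obtain ⟨r⟩ := hg
    obtain ⟨l, hl₁, hl₂⟩ := hg₂ _ _ r.w
    have e2 : r.left ≫ f = r.right ≫ f := by
      rw [← hl₁, ← hl₂]; simp [hp.w]
    exact ⟨r.isColimit.desc (Cofork.ofπ f e2),
      r.isColimit.fac (Cofork.ofπ f e2) WalkingParallelPair.one⟩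
  obtain ⟨h, hh⟩ := hh
  refine ⟨Y, g, h, hg, hh, IsKernelOf.mk' ?_ (mono_comp t k) ?_⟩
  · obtain ⟨l, hl⟩ := hlift (t ≫ j) (by
      rw [Category.assoc, nat, reassoc_of% ht.1, Category.assoc, reassoc_of% hj₁]; simp)
    rw [← hj₂, Category.assoc, Category.assoc, ← reassoc_of% hl, ← hg₁, reassoc_of% hl,
      reassoc_of% hj₁]
    simp
  · intro Z x hx
    obtain ⟨z, hz₁, hz₂⟩ := hg₂ 0 x (by rw [hx, zero_comp])
    obtain ⟨y, hy⟩ := hj.exists_lift (z ≫ i) (by rw [Category.assoc, hz₁])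
    have hyk : y ≫ k = x := by rw [← hj₂, reassoc_of% hy, hz₂]
    obtain ⟨y', hy'⟩ := ht.exists_lift y (by
      rw [← cancel_mono (R.F.map j), Category.assoc, ← nat, reassoc_of% hy, hi,
        reassoc_of% hz₁, zero_comp, zero_comp])
    exact ⟨y', by rw [reassoc_of% hy', hyk]⟩

end Aux

/-- Proposition 2.9. Let `C` be a semi-abelian category and `R` a
protoadditive reflector onto a full replete (normal epi)-reflective subcategory `P`.
Then `P` is a torsion-free subcategory of `C` if and only if `P` is closed under
extensions in `C`. -/
theorem statement6 {C : Type u} [Category.{v} C] [HasZeroObject C] [HasZeroMorphisms C]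
    (hC : IsSemiAbelian C) {P : C → Prop} (hrepl : Replete P)
    (R : Reflection C P) (hne : NormalEpiUnits R) (hproto : IsProtoadditive R.F) :
    (∃ Tp : C → Prop, TorsionTheory C Tp P) ↔
      (∀ ⦃K A B : C⦄ (k : K ⟶ A) (f : A ⟶ B), IsShortExact k f →
        P K → P B → P A) := by
  have hfl := hC.homological.hasFiniteLimits
  constructor
  · rintro ⟨Tp, hT⟩ K A B k f hs hK hB
    obtain ⟨TA, FA, t, q, hTA, hFA, htq⟩ := hT.exists_ses A
    obtain ⟨l, hl⟩ := hs.isKernel.exists_lift t (hT.hom_zero (t ≫ f) hTA hB)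
    have ht : t = 0 := by rw [← hl, hT.hom_zero l hTA hK, zero_comp]
    obtain ⟨r, hr⟩ := htq.isCokernel.exists_desc (𝟙 A) (by rw [ht, zero_comp])
    have hq := htq.isCokernel.epi
    refine hrepl hFA ⟨r, q, ?_, hr⟩
    rw [← cancel_epi q, reassoc_of% hr, Category.comp_id]
  · intro hext
    refine ⟨fun X => ∀ ⦃Y : C⦄ (f : X ⟶ Y), P Y → f = 0, ?_, hrepl,
      fun X Y f hX hY => hX f hY, ?_⟩
    · intro X Y hX e Z f hZ
      rw [← cancel_epi e.hom, hX (e.hom ≫ f) hZ, comp_zero]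
    · intro A
      obtain ⟨K, k, hk⟩ := exists_kernelOf (R.η.app A)
      have hcok := (hne A).isCokernelOf hk
      refine ⟨K, R.F.obj A, k, R.η.app A, ?_, R.mem A, hk, hcok⟩
      obtain ⟨TK, t, ht⟩ := exists_kernelOf (R.η.app K)
      have htcok := (hne K).isCokernelOf ht
      obtain ⟨Y, g, h, hg, hgh, hkg⟩ := exists_quotient hC R hproto hk ht
      have hgepi : Epi g := by
        obtain ⟨_, _, hn⟩ := isNormalEpiArrow_of_regularEpi hC.homological.protomodular g hg
        exact hn.epi
      obtain ⟨L, l, hl⟩ := exists_kernelOf h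
      have hlm := hl.mono
      have hkm := hk.mono
      obtain ⟨e, he⟩ := hl.exists_lift (k ≫ g) (by rw [Category.assoc, hgh]; exact hk.1)
      have hpb : IsPullback k e g l := by
        have hex : ∀ s : PullbackCone g l, ∃ z : s.pt ⟶ K, z ≫ k = s.fst := fun s =>
          hk.exists_lift s.fst (by
            rw [← hgh, ← Category.assoc, s.condition, Category.assoc, hl.1, comp_zero])
        choose z hz using hex
        refine ⟨⟨he.symm⟩, ⟨PullbackCone.IsLimit.mk he.symm z hz ?_ ?_⟩⟩
        · intro s
          rw [← cancel_mono l, Category.assoc, he, ← s.condition, ← Category.assoc, hz]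
        · intro s m hm _
          rw [← cancel_mono k, hm, hz]
      have hereg := hC.homological.regEpiStable _ _ _ _ hpb hg
      have hte : IsKernelOf t e := by
        refine IsKernelOf.mk' ?_ ht.mono ?_
        · rw [← cancel_mono l, Category.assoc, he, ← Category.assoc, hkg.1, zero_comp]
        · intro Z x hx
          obtain ⟨y, hy⟩ := hkg.exists_lift (x ≫ k) (by
            rw [Category.assoc, ← he, reassoc_of% hx, zero_comp])
          exact ⟨y, by rw [← cancel_mono k, Category.assoc, hy]⟩
      have hecok := (isNormalEpiArrow_of_regularEpi hC.homological.protomodular e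
        hereg).isCokernelOf hte
      have heepi := hecok.epi
      have hηepi := htcok.epi
      have hPL : P L := by
        obtain ⟨u, hu⟩ := hecok.exists_desc (R.η.app K) ht.1
        obtain ⟨v, hv⟩ := htcok.exists_desc e hte.1
        refine hrepl (R.mem K) ⟨v, u, ?_, ?_⟩
        · rw [← cancel_epi (R.η.app K), reassoc_of% hv, hu]; exact (Category.comp_id _).symm
        · rw [← cancel_epi e, reassoc_of% hu, hv, Category.comp_id]
      have hhepi : Epi h := by
        have := hcok.epi
        have : Epi (g ≫ h) := by rw [hgh]; exact this
        exact epi_of_epi g h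
      have hPY : P Y := by
        refine hext l h ⟨hl, IsCokernelOf.mk' hl.1 hhepi ?_⟩ hPL (R.mem A)
        intro Z x hx
        obtain ⟨y, hy⟩ := hcok.exists_desc (g ≫ x) (by
          rw [← Category.assoc, ← he, Category.assoc, hx, comp_zero])
        exact ⟨y, by rw [← cancel_epi g, ← Category.assoc, hgh, hy]⟩
      have hkg0 : k ≫ g = 0 := by
        obtain ⟨g', hg', _⟩ := R.univ hPY g
        have h0 : k ≫ R.η.app A ≫ g' = 0 := by rw [← Category.assoc, hk.1, zero_comp]
        rw [← hg']
        exact h0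
      obtain ⟨y, hy⟩ := hkg.exists_lift k hkg0
      have hyt : y ≫ t = 𝟙 K := by rw [← cancel_mono k, Category.assoc, hy, Category.id_comp]
      have hη : R.η.app K = 0 := by
        have : y ≫ t ≫ R.η.app K = 0 := by rw [ht.1, comp_zero]
        rw [reassoc_of% hyt] at this
        exact this
      intro Z x hZ
      obtain ⟨x', hx', _⟩ := R.univ hZ x
      rw [← hx', hη, zero_comp]

end ProtoPaper
end
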